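/- arXiv:2203.09732 — 3 statements merged into one kernel-verified Lean document; each statement's English description precedes it below -/
import Mathlib

section
/- Let L ≥ 2 be an integer, B = (Fin L → Bool), and let U ∈ Matrix B B ℂ be the diagonal twist matrix with U_{s,s} = exp((2πi/L)·∑_{k=1}^{L} k·val(s_k)). For each site j ∈ {1,…,L}, let S⁺_j ∈ Matrix B B ℂ be the raising matrix with (S⁺_j)_{s,t} = 1 if s(j) = true, t(j) = false and s(k) = t(k) for all k ≠ j, and 0 otherwise, and let S⁻_j = (S⁺_j)ᵀ. Then U⁻¹ · S⁺_j · U = exp(−2πi·j/L) · S⁺_j and U⁻¹ · S⁻_j · U = exp(2πi·j/L) · S⁻_j. (Since U is unitary, U⁻¹ equals the conjugate transpose U†.) -/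
open Complex Matrix

noncomputable section

/-- Spin value of a boolean: `1/2` for up (`true`), `-1/2` for down (`false`). -/
def sval (b : Bool) : ℝ := if b then 1/2 else -1/2

/-- Diagonal entry of the twist operator for a spin configuration `s`:
`exp((2πi/L) ∑_{j=1}^L j · val(s_j))`, where site `j ∈ {1,…,L}` is coordinate
`j - 1` of `Fin L`. -/
def twistEntry (L : ℕ) (s : Fin L → Bool) : ℂ :=
  Complex.exp ((2 * Real.pi * Complex.I / L) *
    ∑ j : Fin L, ((j.val : ℂ) + 1) * ((sval (s j) : ℝ) : ℂ))

/-- The twist operator as a diagonal matrix on the configuration space. -/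
def twistMat (L : ℕ) : Matrix (Fin L → Bool) (Fin L → Bool) ℂ :=
  Matrix.diagonal (fun s => twistEntry L s)

/-- The spin operator `S^z_j`, diagonal with entry `val(s_j)`. -/
def Sz (L : ℕ) (j : Fin L) : Matrix (Fin L → Bool) (Fin L → Bool) ℂ :=
  Matrix.diagonal (fun s => ((sval (s j) : ℝ) : ℂ))

/-- The raising operator `S⁺_j`: entry `(s, t)` is `1` iff `s` is obtained from
`t` by flipping the spin at site `j` from down to up. -/
def Sp (L : ℕ) (j : Fin L) : Matrix (Fin L → Bool) (Fin L → Bool) ℂ :=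
  fun s t =>
    if s j = true ∧ t j = false ∧ ∀ k : Fin L, k ≠ j → s k = t k then 1 else 0

/-- The lowering operator `S⁻_j = (S⁺_j)ᵀ`. -/
def Sm (L : ℕ) (j : Fin L) : Matrix (Fin L → Bool) (Fin L → Bool) ℂ := (Sp L j)ᵀ

/-- `S^x_j = (S⁺_j + S⁻_j)/2`. -/
def Sx (L : ℕ) (j : Fin L) : Matrix (Fin L → Bool) (Fin L → Bool) ℂ :=
  ((1 : ℂ)/2) • (Sp L j + Sm L j)

/-- `S^y_j = (S⁺_j − S⁻_j)/(2i)`. -/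
def Sy (L : ℕ) (j : Fin L) : Matrix (Fin L → Bool) (Fin L → Bool) ℂ :=
  ((1 : ℂ)/(2 * Complex.I)) • (Sp L j - Sm L j)

/-- The random-field Heisenberg Hamiltonian
`H = ∑_j (J (S^x_j S^x_{j+1} + S^y_j S^y_{j+1} + S^z_j S^z_{j+1}) − h_j S^z_j)`,
with periodic boundary conditions (`j + 1` taken cyclically in `Fin L`). -/
def Ham (L : ℕ) [NeZero L] (J : ℝ) (h : Fin L → ℝ) :
    Matrix (Fin L → Bool) (Fin L → Bool) ℂ :=
  ∑ j : Fin L,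
    ((J : ℂ) • (Sx L j * Sx L (j + 1) + Sy L j * Sy L (j + 1)
        + Sz L j * Sz L (j + 1))
      - ((h j : ℝ) : ℂ) • Sz L j)

end


/-- The twist phases of `s` and of `t`, obtained from `s` by lowering the spin at site `j`,
differ by `exp (2πi j / L)`. -/
theorem twistEntry_of_flip {L : ℕ} {j : Fin L} {s t : Fin L → Bool} (hs : s j = true)
    (ht : t j = false) (hst : ∀ k : Fin L, k ≠ j → s k = t k) :
    twistEntry L s
      = Complex.exp ((2 * Real.pi * Complex.I) * ((j.val : ℂ) + 1) / L) * twistEntry L t := by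
  have hsum : ∑ k : Fin L, ((k.val : ℂ) + 1) * ((sval (s k) : ℝ) : ℂ)
      = ((j.val : ℂ) + 1) + ∑ k : Fin L, ((k.val : ℂ) + 1) * ((sval (t k) : ℝ) : ℂ) := by
    rw [← sub_eq_iff_eq_add, ← Finset.sum_sub_distrib, Finset.sum_eq_single j]
    · simp only [hs, ht, sval]
      push_cast
      norm_num
      ring
    · intro k _ hk
      rw [hst k hk, sub_self]
    · simp
  rw [twistEntry, twistEntry, hsum, ← Complex.exp_add]
  ring_nf

theorem twistEntry_ne_zero (L : ℕ) (s : Fin L → Bool) : twistEntry L s ≠ 0 :=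
  Complex.exp_ne_zero _

theorem twistMat_inv (L : ℕ) :
    (twistMat L)⁻¹ = Matrix.diagonal (fun s => (twistEntry L s)⁻¹) := by
  apply Matrix.inv_eq_right_inv
  simp [twistMat, Matrix.diagonal_mul_diagonal, twistEntry_ne_zero]

theorem twistMat_conj_apply (L : ℕ) (A : Matrix (Fin L → Bool) (Fin L → Bool) ℂ)
    (s t : Fin L → Bool) :
    ((twistMat L)⁻¹ * A * twistMat L) s t = (twistEntry L s)⁻¹ * A s t * twistEntry L t := by
  rw [twistMat_inv, twistMat, Matrix.mul_diagonal, Matrix.diagonal_mul]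

/-- Conjugation of the raising and lowering operators by the twist operator:
`U⁻¹ S⁺_j U = e^{-2πi j / L} S⁺_j` and `U⁻¹ S⁻_j U = e^{2πi j / L} S⁻_j`,
where the site number of `j : Fin L` is `j.val + 1`. -/
theorem twist_conj_raising_lowering (L : ℕ) (hL : 2 ≤ L) (j : Fin L) :
    (twistMat L)⁻¹ * Sp L j * twistMat L
        = Complex.exp (-(2 * Real.pi * Complex.I) * ((j.val : ℂ) + 1) / L) • Sp L j
      ∧
    (twistMat L)⁻¹ * Sm L j * twistMat L
        = Complex.exp ((2 * Real.pi * Complex.I) * ((j.val : ℂ) + 1) / L) • Sm L j := by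
  constructor
  · ext s t
    rw [twistMat_conj_apply, Matrix.smul_apply, smul_eq_mul, Sp]
    split_ifs with h
    · have ht := twistEntry_ne_zero L t
      rw [twistEntry_of_flip h.1 h.2.1 h.2.2, neg_mul, neg_div, Complex.exp_neg]
      have := Complex.exp_ne_zero (2 * Real.pi * Complex.I * ((j.val : ℂ) + 1) / L)
      field_simp
    · simp
  · ext s t
    rw [twistMat_conj_apply, Matrix.smul_apply, smul_eq_mul, Sm, Matrix.transpose_apply, Sp]
    split_ifs with h
    · have hs := twistEntry_ne_zero L s
      rw [twistEntry_of_flip h.1 h.2.1 h.2.2]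
      field_simp
    · simp
end

section
/- Let L ≥ 2 be an integer, J ∈ ℝ, h : Fin L → ℝ, and B = (Fin L → Bool). With the spin matrices S^z_j, S⁺_j, S⁻_j, S^x_j, S^y_j and Hamiltonian H = ∑_{j=1}^{L} ( J(S^x_j S^x_{j+1} + S^y_j S^y_{j+1} + S^z_j S^z_{j+1}) − h_j S^z_j ) (site L+1 identified with site 1), and with U the diagonal twist matrix, one has the exact matrix identity: U⁻¹ H U − H = (J/2)(cos(2π/L) − 1) ∑_{j=1}^{L} (S⁺_j S⁻_{j+1} + S⁻_j S⁺_{j+1}) + i(J/2) sin(2π/L) ∑_{j=1}^{L} (S⁺_j S⁻_{j+1} − S⁻_j S⁺_{j+1}). In particular the random-field terms −h_j S^z_j are invariant under conjugation by U. -/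
open Complex Matrix

theorem isUnit_det_twistMat (L : ℕ) : IsUnit (twistMat L).det := by
  rw [twistMat, Matrix.det_diagonal, isUnit_iff_ne_zero]
  exact Finset.prod_ne_zero_iff.mpr fun s _ => twistEntry_ne_zero L s

/-- Flipping site `j` from down to up multiplies the twist entry by `exp(2πi(j+1)/L)`. -/
theorem twistEntry_raise (L : ℕ) (j : Fin L) (s t : Fin L → Bool) (hs : s j = true)
    (ht : t j = false) (hst : ∀ k : Fin L, k ≠ j → s k = t k) :
    twistEntry L s
      = Complex.exp ((2 * Real.pi * Complex.I / L) * ((j.val : ℂ) + 1)) * twistEntry L t := by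
  have hsum : ∑ k : Fin L, ((k.val : ℂ) + 1) * ((sval (s k) : ℝ) : ℂ)
      = ((j.val : ℂ) + 1) + ∑ k : Fin L, ((k.val : ℂ) + 1) * ((sval (t k) : ℝ) : ℂ) := by
    rw [← Finset.add_sum_erase _ _ (Finset.mem_univ j),
      ← Finset.add_sum_erase Finset.univ
        (fun k : Fin L => ((k.val : ℂ) + 1) * ((sval (t k) : ℝ) : ℂ)) (Finset.mem_univ j),
      Finset.sum_congr rfl fun k hk => by rw [hst k (Finset.ne_of_mem_erase hk)]]
    rw [hs, ht, show sval true = 1 / 2 from rfl, show sval false = -1 / 2 from rfl]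
    push_cast
    ring
  rw [twistEntry, twistEntry, hsum, mul_add, Complex.exp_add]

theorem twistMat_mul_Sp (L : ℕ) (j : Fin L) :
    twistMat L * Sp L j
      = Complex.exp ((2 * Real.pi * Complex.I / L) * ((j.val : ℂ) + 1)) •
          (Sp L j * twistMat L) := by
  ext s t
  rw [twistMat, Matrix.diagonal_mul, Matrix.smul_apply, Matrix.mul_diagonal, smul_eq_mul, Sp]
  split_ifs with hst
  · rw [twistEntry_raise L j s t hst.1 hst.2.1 hst.2.2]
    ring
  · simp

theorem Sm_mul_twistMat (L : ℕ) (j : Fin L) :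
    Sm L j * twistMat L
      = Complex.exp ((2 * Real.pi * Complex.I / L) * ((j.val : ℂ) + 1)) •
          (twistMat L * Sm L j) := by
  have hU : (twistMat L)ᵀ = twistMat L := Matrix.diagonal_transpose _
  simpa [Sm, Matrix.transpose_mul, hU] using congrArg Matrix.transpose (twistMat_mul_Sp L j)

theorem Sp_mul_twistMat (L : ℕ) (j : Fin L) :
    Sp L j * twistMat L
      = (Complex.exp ((2 * Real.pi * Complex.I / L) * ((j.val : ℂ) + 1)))⁻¹ •
          (twistMat L * Sp L j) := by
  rw [twistMat_mul_Sp, smul_smul, inv_mul_cancel₀ (Complex.exp_ne_zero _), one_smul]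

/-- The site phases are consistent with the periodic boundary conditions. -/
theorem exp_site_succ (L : ℕ) [NeZero L] (j : Fin L) :
    Complex.exp ((2 * Real.pi * Complex.I / L) * (((j + 1 : Fin L).val : ℂ) + 1))
      = Complex.exp (2 * Real.pi * Complex.I / L) *
          Complex.exp ((2 * Real.pi * Complex.I / L) * ((j.val : ℂ) + 1)) := by
  have hL : (L : ℂ) ≠ 0 := Nat.cast_ne_zero.mpr (NeZero.ne L)
  have hmod : (j + 1 : Fin L).val = (j.val + 1) % L := by
    rw [Fin.val_add, Fin.val_one', Nat.add_mod_mod]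
  have hdiv : (((j.val + 1) % L : ℕ) : ℂ) + L * (((j.val + 1) / L : ℕ) : ℂ) = (j.val : ℂ) + 1 := by
    exact_mod_cast Nat.mod_add_div (j.val + 1) L
  rw [hmod, ← Complex.exp_add, Complex.exp_eq_exp_iff_exists_int]
  refine ⟨-(((j.val + 1) / L : ℕ) : ℤ), ?_⟩
  rw [← hdiv, Int.cast_neg, Int.cast_natCast]
  field_simp
  ring

theorem Sp_mul_Sm_mul_twistMat (L : ℕ) [NeZero L] (j : Fin L) :
    Sp L j * Sm L (j + 1) * twistMat L
      = Complex.exp (2 * Real.pi * Complex.I / L) •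
          (twistMat L * (Sp L j * Sm L (j + 1))) := by
  rw [Matrix.mul_assoc, Sm_mul_twistMat, Matrix.mul_smul, ← Matrix.mul_assoc, Sp_mul_twistMat,
    Matrix.smul_mul, smul_smul, exp_site_succ, mul_assoc,
    mul_inv_cancel₀ (Complex.exp_ne_zero _), mul_one, Matrix.mul_assoc]

theorem Sm_mul_Sp_mul_twistMat (L : ℕ) [NeZero L] (j : Fin L) :
    Sm L j * Sp L (j + 1) * twistMat L
      = Complex.exp (-(2 * Real.pi * Complex.I / L)) •
          (twistMat L * (Sm L j * Sp L (j + 1))) := by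
  rw [Matrix.mul_assoc, Sp_mul_twistMat, Matrix.mul_smul, ← Matrix.mul_assoc, Sm_mul_twistMat,
    Matrix.smul_mul, smul_smul, exp_site_succ, mul_inv, mul_assoc,
    inv_mul_cancel₀ (Complex.exp_ne_zero _), mul_one, Matrix.mul_assoc, Complex.exp_neg]

theorem Sz_mul_twistMat (L : ℕ) (j : Fin L) : Sz L j * twistMat L = twistMat L * Sz L j := by
  simp only [Sz, twistMat, Matrix.diagonal_mul_diagonal, mul_comm]

/-- The transverse exchange in terms of raising and lowering operators. -/
theorem Sx_mul_Sx_add_Sy_mul_Sy (L : ℕ) (j k : Fin L) :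
    Sx L j * Sx L k + Sy L j * Sy L k
      = ((1 : ℂ) / 2) • (Sp L j * Sm L k + Sm L j * Sp L k) := by
  have hI : (1 : ℂ) / (2 * Complex.I) * (1 / (2 * Complex.I)) = -(1 / 4) := by
    field_simp
    rw [Complex.I_sq]
    norm_num
  simp only [Sx, Sy, Matrix.smul_mul, Matrix.mul_smul, smul_smul, hI]
  simp only [Matrix.add_mul, Matrix.mul_add, Matrix.sub_mul, Matrix.mul_sub]
  module

theorem exp_two_pi_I_div (L : ℕ) :
    Complex.exp (2 * Real.pi * Complex.I / L)
      = ((Real.cos (2 * Real.pi / L) : ℝ) : ℂ)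
        + ((Real.sin (2 * Real.pi / L) : ℝ) : ℂ) * Complex.I := by
  rw [Complex.ofReal_cos, Complex.ofReal_sin, ← Complex.exp_mul_I]
  push_cast
  ring_nf

theorem exp_neg_two_pi_I_div (L : ℕ) :
    Complex.exp (-(2 * Real.pi * Complex.I / L))
      = ((Real.cos (2 * Real.pi / L) : ℝ) : ℂ)
        - ((Real.sin (2 * Real.pi / L) : ℝ) : ℂ) * Complex.I := by
  rw [Complex.ofReal_cos, Complex.ofReal_sin, sub_eq_add_neg, ← neg_mul, ← Complex.sin_neg,
    ← Complex.cos_neg, ← Complex.exp_mul_I]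
  push_cast
  ring_nf

/-- Exact identity for the twist-conjugated random-field Heisenberg Hamiltonian:
`U⁻¹ H U − H = (J/2)(cos(2π/L) − 1) ∑_j (S⁺_j S⁻_{j+1} + S⁻_j S⁺_{j+1})
             + i (J/2) sin(2π/L) ∑_j (S⁺_j S⁻_{j+1} − S⁻_j S⁺_{j+1})`.
In particular the random-field terms `−h_j S^z_j` are invariant. -/
theorem twist_conj_hamiltonian (L : ℕ) [NeZero L] (hL : 2 ≤ L)
    (J : ℝ) (h : Fin L → ℝ) :
    (twistMat L)⁻¹ * Ham L J h * twistMat L - Ham L J h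
      = (((J : ℂ) / 2) * ((Real.cos (2 * Real.pi / L) : ℝ) - 1)) •
          (∑ j : Fin L, (Sp L j * Sm L (j + 1) + Sm L j * Sp L (j + 1)))
        + (Complex.I * ((J : ℂ) / 2) * ((Real.sin (2 * Real.pi / L) : ℝ) : ℂ)) •
          (∑ j : Fin L, (Sp L j * Sm L (j + 1) - Sm L j * Sp L (j + 1))) := by
  have hU := isUnit_det_twistMat L
  suffices hcomm : Ham L J h * twistMat L = twistMat L * (Ham L J h +
      ((((J : ℂ) / 2) * ((Real.cos (2 * Real.pi / L) : ℝ) - 1)) •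
          (∑ j : Fin L, (Sp L j * Sm L (j + 1) + Sm L j * Sp L (j + 1)))
        + (Complex.I * ((J : ℂ) / 2) * ((Real.sin (2 * Real.pi / L) : ℝ) : ℂ)) •
          (∑ j : Fin L, (Sp L j * Sm L (j + 1) - Sm L j * Sp L (j + 1))))) by
    rw [Matrix.mul_assoc, hcomm, Matrix.nonsing_inv_mul_cancel_left _ _ hU, add_sub_cancel_left]
  rw [Ham, Finset.smul_sum, Finset.smul_sum, ← Finset.sum_add_distrib, ← Finset.sum_add_distrib,
    Finset.sum_mul, Finset.mul_sum]
  refine Finset.sum_congr rfl fun j _ => ?_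
  have hzz : Sz L j * Sz L (j + 1) * twistMat L = twistMat L * (Sz L j * Sz L (j + 1)) := by
    rw [Matrix.mul_assoc, Sz_mul_twistMat, ← Matrix.mul_assoc, Sz_mul_twistMat, Matrix.mul_assoc]
  simp only [Sx_mul_Sx_add_Sy_mul_Sy, Matrix.add_mul, Matrix.sub_mul, Matrix.smul_mul,
    Matrix.mul_add, Matrix.mul_sub, Matrix.mul_smul, Sp_mul_Sm_mul_twistMat,
    Sm_mul_Sp_mul_twistMat, hzz, Sz_mul_twistMat, exp_two_pi_I_div, exp_neg_two_pi_I_div]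
  module
end

section
/- Let L ≥ 2 be an integer and j ∈ {1,…,L} a site (indices cyclic, site L+1 identified with site 1). Let s : Fin L → Bool be a spin configuration with s(j) = true and s(j+1) = false, and let s' be the configuration obtained from s by swapping the values at sites j and j+1 (so s'(j) = false, s'(j+1) = true, and s'(k) = s(k) for all other k). Then exp((2πi/L)·∑_{k=1}^{L} k·val(s'_k)) = exp(2πi/L) · exp((2πi/L)·∑_{k=1}^{L} k·val(s_k)). In other words, flipping an antiparallel nearest-neighbor spin pair multiplies the diagonal twist entry by a phase e^{±2πi/L}; the integer d measuring the phase in units of 2π/L satisfies |d| = 1. -/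
open Complex Matrix

/-- The successor of a site in `Fin L` is the next integer, or wraps around to `0`. -/
theorem val_add_one_eq_or {L : ℕ} [NeZero L] (hL : 2 ≤ L) (j : Fin L) :
    (j + 1).val = j.val + 1 ∨ (j + 1).val + L = j.val + 1 := by
  have h1 : ((1 : Fin L) : ℕ) = 1 := by
    rw [Fin.val_one', Nat.mod_eq_of_lt (by omega)]
  have hj := j.isLt
  rw [Fin.val_add, h1]
  rcases Nat.lt_or_ge (j.val + 1) L with h | h
  · exact Or.inl (Nat.mod_eq_of_lt h)
  · have h' : j.val + 1 = L := by omega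
    right
    rw [h', Nat.mod_self, Nat.zero_add]

/-- Swapping an (up, down) pair at sites `a`, `b` changes any weighted magnetization
by the difference of the weights. -/
theorem sum_mul_sval_swap {ι : Type*} [Fintype ι] [DecidableEq ι] (w : ι → ℂ) (s : ι → Bool)
    {a b : ι} (ha : s a = true) (hb : s b = false) :
    ∑ k, w k * ((sval (if k = a then false else if k = b then true else s k) : ℝ) : ℂ)
      = (w b - w a) + ∑ k, w k * ((sval (s k) : ℝ) : ℂ) := by
  have hab : a ≠ b := by
    rintro rfl
    simp [ha] at hb
  have hterm : ∀ k,
      w k * ((sval (if k = a then false else if k = b then true else s k) : ℝ) : ℂ)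
        = ((if k = b then w k else 0) - (if k = a then w k else 0))
          + w k * ((sval (s k) : ℝ) : ℂ) := by
    intro k
    by_cases hka : k = a
    · subst hka
      simp [hab, ha, sval]
      ring
    · by_cases hkb : k = b
      · subst hkb
        simp [hka, hb, sval]
        ring
      · simp [hka, hkb]
  simp only [hterm, Finset.sum_add_distrib, Finset.sum_sub_distrib, Finset.sum_ite_eq',
    Finset.mem_univ, if_true]

/-- Swapping an antiparallel (up, down) nearest-neighbor pair at sites `j`, `j+1`
multiplies the diagonal twist entry by the phase `e^{2πi/L}`. -/
theorem twistEntry_swap (L : ℕ) [NeZero L] (hL : 2 ≤ L) (j : Fin L)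
    (s : Fin L → Bool) (hj : s j = true) (hj1 : s (j + 1) = false) :
    twistEntry L
        (fun k : Fin L => if k = j then false else if k = j + 1 then true else s k)
      = Complex.exp (2 * Real.pi * Complex.I / L) * twistEntry L s := by
  have hL0 : (L : ℂ) ≠ 0 := Nat.cast_ne_zero.mpr (NeZero.ne L)
  unfold twistEntry
  rw [sum_mul_sval_swap (fun k : Fin L => (k.val : ℂ) + 1) s hj hj1, mul_add, Complex.exp_add]
  congr 1
  rcases val_add_one_eq_or hL j with h | h
  · rw [h]
    congr 1
    push_cast
    ring
  · have hc : ((j + 1).val : ℂ) + L = j.val + 1 := by exact_mod_cast h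
    rw [← Complex.exp_periodic.sub_eq (2 * Real.pi * Complex.I / L), eq_sub_of_add_eq hc]
    congr 1
    field_simp
    ring
end
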